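/- Hyperbolic reducible walls in PU(2,1): The set of τ ∈ (𝒯°)³ for which there exist A, B, C ∈ U(2,1) of elliptic types (α₁,α₂), (β₁,β₂), (γ₁,γ₂) respectively, with A·B·C = λ·I₃ for some λ ∈ ℂ, together with a common eigenvector v ∈ ℂ³∖{0} of A, B and C satisfying vᴴ·J·v > 0, equals W ∩ (𝒯°)³, where W ⊆ 𝒯³ is the union of the following twenty-four truncated hyperplanes: {H₂₂₂ = −4π}; {H_{ijk} = 0, σ_{ī j̄ k̄} ≥ 4π} for (i,j,k) ∈ {(2,2,2),(2,2,1),(2,1,2),(1,2,2)}; {H_{ijk} = 2π, σ_{ī j̄ k̄} ≤ 2π} for (i,j,k) ∈ {(2,2,1),(2,1,2),(1,2,2),(1,1,2),(1,2,1),(2,1,1),(1,1,1)}; {H_{ijk} = 4π, σ_{ī j̄ k̄} ≥ 4π} for (i,j,k) ∈ {(2,2,2),(2,2,1),(2,1,2),(1,2,2),(1,1,2),(1,2,1),(2,1,1)}; {H_{ijk} = 6π, σ_{ī j̄ k̄} ≤ 2π} for (i,j,k) ∈ {(1,1,1),(1,1,2),(1,2,1),(2,1,1)}; and {H₁₁₁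 = 10π}. -/

import Mathlib

open Real Matrix Set

noncomputable section

abbrev Pt : Type := ℝ × ℝ
abbrev Tri : Type := Pt × Pt × Pt

/-- Membership in `𝒯 = {(a₁,a₂) ∈ [0,2π)² : a₁ ≥ a₂}`. -/
def memT (p : Pt) : Prop :=
  0 ≤ p.1 ∧ p.1 < 2 * π ∧ 0 ≤ p.2 ∧ p.2 < 2 * π ∧ p.2 ≤ p.1

def memT3 (τ : Tri) : Prop := memT τ.1 ∧ memT τ.2.1 ∧ memT τ.2.2

/-- Membership in the interior `𝒯° = {(a₁,a₂) : 0 < a₂ < a₁ < 2π}`. -/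
def memTo (p : Pt) : Prop := 0 < p.2 ∧ p.2 < p.1 ∧ p.1 < 2 * π

def memTo3 (τ : Tri) : Prop := memTo τ.1 ∧ memTo τ.2.1 ∧ memTo τ.2.2

/-- The sum `S(τ) = α₁+α₂+β₁+β₂+γ₁+γ₂`. -/
def Sf (τ : Tri) : ℝ := τ.1.1 + τ.1.2 + τ.2.1.1 + τ.2.1.2 + τ.2.2.1 + τ.2.2.2

/-- The coordinate of a pair: index `0` is the first coordinate (subscript 1),
index `1` the second (subscript 2). -/
def coord (p : Pt) (i : Fin 2) : ℝ := if i = 0 then p.1 else p.2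

/-- `sg τ i j k = σ_{(i+1)(j+1)(k+1)}(τ) = α_i + β_j + γ_k` (indices in `Fin 2`,
index `0` ↔ subscript 1, index `1` ↔ subscript 2). -/
def sg (τ : Tri) (i j k : Fin 2) : ℝ := coord τ.1 i + coord τ.2.1 j + coord τ.2.2 k

/-- `Hf τ i j k = 2 σ_{ijk}(τ) − σ_{ī j̄ k̄}(τ)`, the complementary index being `i+1` in `Fin 2`. -/
def Hf (τ : Tri) (i j k : Fin 2) : ℝ := 2 * sg τ i j k - sg τ (i + 1) (j + 1) (k + 1)

abbrev M3 : Type := Matrix (Fin 3) (Fin 3) ℂ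

/-- The form J = diag(1, 1, −1). -/
def J3 : M3 := Matrix.diagonal ![1, 1, -1]

/-- Membership in U(2,1). -/
def memU21 (M : M3) : Prop := Mᴴ * J3 * M = J3

/-- The diagonal matrix E(a₁,a₂) = diag(e^{ia₁}, e^{ia₂}, 1). -/
def Emat (a₁ a₂ : ℝ) : M3 :=
  Matrix.diagonal ![Complex.exp (a₁ * Complex.I), Complex.exp (a₂ * Complex.I), 1]

/-- `M` is of elliptic type `(a₁,a₂)`: conjugate in U(2,1) to E(a₁,a₂). -/
def ellType (M : M3) (a₁ a₂ : ℝ) : Prop :=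
  ∃ P : M3, memU21 P ∧ M = P * Emat a₁ a₂ * P⁻¹

/-- The union `W ⊆ 𝒯³` of the twenty-four hyperbolic reducible walls.
Indices in `Fin 2`: index `0` ↔ subscript 1, index `1` ↔ subscript 2. -/
def Wred : Set Tri := {τ | memT3 τ ∧ (
  -- {H₂₂₂ = −4π}
  Hf τ 1 1 1 = -(4 * π) ∨
  -- {H_{ijk} = 0, σ̄ ≥ 4π}, (i,j,k) ∈ {(2,2,2),(2,2,1),(2,1,2),(1,2,2)}
  (Hf τ 1 1 1 = 0 ∧ 4 * π ≤ sg τ 0 0 0) ∨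
  (Hf τ 1 1 0 = 0 ∧ 4 * π ≤ sg τ 0 0 1) ∨
  (Hf τ 1 0 1 = 0 ∧ 4 * π ≤ sg τ 0 1 0) ∨
  (Hf τ 0 1 1 = 0 ∧ 4 * π ≤ sg τ 1 0 0) ∨
  -- {H_{ijk} = 2π, σ̄ ≤ 2π}, (i,j,k) ∈ {(2,2,1),(2,1,2),(1,2,2),(1,1,2),(1,2,1),(2,1,1),(1,1,1)}
  (Hf τ 1 1 0 = 2 * π ∧ sg τ 0 0 1 ≤ 2 * π) ∨
  (Hf τ 1 0 1 = 2 * π ∧ sg τ 0 1 0 ≤ 2 * π) ∨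
  (Hf τ 0 1 1 = 2 * π ∧ sg τ 1 0 0 ≤ 2 * π) ∨
  (Hf τ 0 0 1 = 2 * π ∧ sg τ 1 1 0 ≤ 2 * π) ∨
  (Hf τ 0 1 0 = 2 * π ∧ sg τ 1 0 1 ≤ 2 * π) ∨
  (Hf τ 1 0 0 = 2 * π ∧ sg τ 0 1 1 ≤ 2 * π) ∨
  (Hf τ 0 0 0 = 2 * π ∧ sg τ 1 1 1 ≤ 2 * π) ∨
  -- {H_{ijk} = 4π, σ̄ ≥ 4π}, (i,j,k) ∈ {(2,2,2),(2,2,1),(2,1,2),(1,2,2),(1,1,2),(1,2,1),(2,1,1)}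
  (Hf τ 1 1 1 = 4 * π ∧ 4 * π ≤ sg τ 0 0 0) ∨
  (Hf τ 1 1 0 = 4 * π ∧ 4 * π ≤ sg τ 0 0 1) ∨
  (Hf τ 1 0 1 = 4 * π ∧ 4 * π ≤ sg τ 0 1 0) ∨
  (Hf τ 0 1 1 = 4 * π ∧ 4 * π ≤ sg τ 1 0 0) ∨
  (Hf τ 0 0 1 = 4 * π ∧ 4 * π ≤ sg τ 1 1 0) ∨
  (Hf τ 0 1 0 = 4 * π ∧ 4 * π ≤ sg τ 1 0 1) ∨
  (Hf τ 1 0 0 = 4 * π ∧ 4 * π ≤ sg τ 0 1 1) ∨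
  -- {H_{ijk} = 6π, σ̄ ≤ 2π}, (i,j,k) ∈ {(1,1,1),(1,1,2),(1,2,1),(2,1,1)}
  (Hf τ 0 0 0 = 6 * π ∧ sg τ 1 1 1 ≤ 2 * π) ∨
  (Hf τ 0 0 1 = 6 * π ∧ sg τ 1 1 0 ≤ 2 * π) ∨
  (Hf τ 0 1 0 = 6 * π ∧ sg τ 1 0 1 ≤ 2 * π) ∨
  (Hf τ 1 0 0 = 6 * π ∧ sg τ 0 1 1 ≤ 2 * π) ∨
  -- {H₁₁₁ = 10π}
  Hf τ 0 0 0 = 10 * π)}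

lemma ineq_core {t1 t2 t3 x y : ℝ} (h1 : 0 < t1) (h1' : t1 < π) (h2 : 0 < t2) (h2' : t2 < π)
    (h3 : 0 < t3) (h3' : t3 < π) (hx : 1 ≤ x) (hy : 1 ≤ y)
    (e1 : cos t1 * cos t2 - x * (sin t1 * sin t2) = -cos t3)
    (e2 : sin t1 * cos t2 + x * (cos t1 * sin t2) = y * sin t3) : t1 + t2 + t3 ≤ π := by
  have s1 := sin_pos_of_pos_of_lt_pi h1 h1'
  have s2 := sin_pos_of_pos_of_lt_pi h2 h2'
  have s3 := sin_pos_of_pos_of_lt_pi h3 h3'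
  have s12 := mul_pos s1 s2
  by_contra hcon
  push Not at hcon
  by_cases hs : t1 + t2 ≤ π
  · have hc : cos (t1 + t2) < cos (π - t3) :=
      cos_lt_cos_of_nonneg_of_le_pi (by linarith) hs (by linarith)
    rw [cos_add, cos_pi_sub] at hc
    nlinarith
  · push Not at hs
    have hpos : 0 < y * sin t3 := by positivity
    have hneg : sin (t1 + t2) < 0 := by
      have : 0 < sin (t1 + t2 - π) := sin_pos_of_pos_of_lt_pi (by linarith) (by linarith)
      rw [sin_sub_pi] at this
      linarith
    rw [sin_add] at hneg
    have hc1 : 0 < cos t1 := by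
      by_contra h
      push Not at h
      have : cos t1 * sin t2 ≤ 0 := mul_nonpos_of_nonpos_of_nonneg h s2.le
      nlinarith
    have hc2 : cos t2 < - cos t1 := by
      rw [← cos_pi_sub]
      exact cos_lt_cos_of_nonneg_of_le_pi (by linarith) h2'.le (by linarith)
    have hc3 : cos t3 < 1 := by
      have := cos_lt_cos_of_nonneg_of_le_pi le_rfl h3'.le h3
      simpa using this
    have q := sin_sq_add_cos_sq t1
    have key : cos t1 * (cos t1 * cos t2 - x * (sin t1 * sin t2)) < cos t2 := by
      have : 0 < sin t1 * (sin t1 * cos t2 + x * (cos t1 * sin t2)) := by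
        rw [e2]; positivity
      have e : cos t1 * (cos t1 * cos t2 - x * (sin t1 * sin t2)) + sin t1 * (sin t1 * cos t2 + x * (cos t1 * sin t2)) = (sin t1 ^ 2 + cos t1 ^ 2) * cos t2 := by ring
      rw [q] at e
      linarith
    rw [e1] at key
    nlinarith

/-- Existence direction of the trigonometric core. -/
lemma exist_core {t1 t2 t3 : ℝ} (h1 : 0 < t1) (h1' : t1 < π) (h2 : 0 < t2) (h2' : t2 < π)
    (h3 : 0 < t3) (h3' : t3 < π) (h : t1 + t2 + t3 ≤ π) :
    ∃ x : ℝ, 1 ≤ x ∧ cos t1 * cos t2 - x * (sin t1 * sin t2) = -cos t3 ∧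
      0 < sin t1 * cos t2 + x * (cos t1 * sin t2) := by
  have s1 := sin_pos_of_pos_of_lt_pi h1 h1'
  have s2 := sin_pos_of_pos_of_lt_pi h2 h2'
  have s3 := sin_pos_of_pos_of_lt_pi h3 h3'
  have s12 := mul_pos s1 s2
  have hx : (cos t1 * cos t2 + cos t3) / (sin t1 * sin t2) * (sin t1 * sin t2) =
    cos t1 * cos t2 + cos t3 := div_mul_cancel₀ _ s12.ne'
  refine ⟨(cos t1 * cos t2 + cos t3) / (sin t1 * sin t2), ?_, by linarith, ?_⟩
  · rw [le_div_iff₀ s12]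
    have hc : cos (π - t3) ≤ cos (t1 + t2) :=
      cos_le_cos_of_nonneg_of_le_pi (by linarith) (by linarith) (by linarith)
    rw [cos_add, cos_pi_sub] at hc
    linarith
  · generalize (cos t1 * cos t2 + cos t3) / (sin t1 * sin t2) = x at hx
    have q := sin_sq_add_cos_sq t1
    have hc : cos (π - (t1 + t3)) ≤ cos t2 :=
      cos_le_cos_of_nonneg_of_le_pi (by linarith) (by linarith) (by linarith)
    rw [cos_pi_sub, cos_add] at hc
    have s13 := mul_pos s1 s3
    have e : sin t1 * (sin t1 * cos t2 + x * (cos t1 * sin t2)) = cos t2 + cos t1 * cos t3 := by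
      linear_combination cos t1 * hx + cos t2 * q
    have : 0 < sin t1 * (sin t1 * cos t2 + x * (cos t1 * sin t2)) := by rw [e]; linarith
    exact pos_of_mul_pos_right this s1.le

/-- Block matrices preserving the first coordinate line. -/
def Gm (a0 a : ℝ) (p q : ℂ) : M3 :=
  !![Complex.exp (a0 * Complex.I), 0, 0;
     0, Complex.exp (a / 2 * Complex.I) * p, Complex.exp (a / 2 * Complex.I) * q;
     0, Complex.exp (a / 2 * Complex.I) * star q, Complex.exp (a / 2 * Complex.I) * star p]

lemma Gm_mul (a0 a b0 b : ℝ) (p q p' q' : ℂ) :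
    Gm a0 a p q * Gm b0 b p' q' =
      Gm (a0 + b0) (a + b) (p * p' + q * star q') (p * q' + q * star p') := by
  have h1 : Complex.exp ((a0 + b0 : ℝ) * Complex.I) =
    Complex.exp (a0 * Complex.I) * Complex.exp (b0 * Complex.I) := by
    rw [← Complex.exp_add]; congr 1; push_cast; ring
  have h2 : Complex.exp ((a + b : ℝ) / 2 * Complex.I) =
    Complex.exp (a / 2 * Complex.I) * Complex.exp (b / 2 * Complex.I) := by
    rw [← Complex.exp_add]; congr 1; push_cast; ring
  unfold Gm
  rw [h1, h2]
  ext i j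
  fin_cases i <;> fin_cases j <;> simp [Matrix.mul_apply, Fin.sum_univ_three] <;> ring

lemma Gm_one : Gm 0 0 1 0 = 1 := by
  unfold Gm
  ext i j
  fin_cases i <;> fin_cases j <;> simp

lemma conj_exp_I (a : ℝ) :
    (starRingEnd ℂ) (Complex.exp (a * Complex.I)) = (Complex.exp (a * Complex.I))⁻¹ := by
  rw [← Complex.exp_conj, ← Complex.exp_neg]; simp

lemma conj_exp_I2 (a : ℝ) :
    (starRingEnd ℂ) (Complex.exp (a / 2 * Complex.I)) = (Complex.exp (a / 2 * Complex.I))⁻¹ := by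
  have := conj_exp_I (a / 2)
  push_cast at this
  exact this

lemma Gm_U (a0 a : ℝ) (p q : ℂ) (h : p * star p - q * star q = 1) : memU21 (Gm a0 a p q) := by
  have k1 := conj_exp_I a0
  have k2 := conj_exp_I2 a
  have n1 := Complex.exp_ne_zero (a0 * Complex.I)
  have n2 := Complex.exp_ne_zero (a / 2 * Complex.I)
  have m1 := inv_mul_cancel₀ n1
  have m2 := inv_mul_cancel₀ n2
  simp at h
  unfold memU21 Gm J3
  ext i j
  fin_cases i <;> fin_cases j <;>
    simp [Matrix.mul_apply, Fin.sum_univ_three, k1, k2, Matrix.diagonal_apply]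
  · field_simp
    linear_combination h
  · field_simp
    ring
  · field_simp
    ring
  · field_simp
    linear_combination -h

lemma Gm_inv (p q : ℂ) (h : p * star p - q * star q = 1) :
    (Gm 0 0 p q)⁻¹ = Gm 0 0 (star p) (-q) := by
  apply Matrix.inv_eq_right_inv
  rw [Gm_mul]
  have e1 : p * star p + q * star (-q) = 1 := by simp at h ⊢; linear_combination h
  have e2 : p * -q + q * star (star p) = 0 := by simp; ring
  rw [e1, e2]; simpa using Gm_one

lemma Emat_eq (a0 a : ℝ) : Emat a0 a = Gm a0 a (Complex.exp (a / 2 * Complex.I)) 0 := by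
  have k2 := conj_exp_I2 a
  have n2 := Complex.exp_ne_zero (a / 2 * Complex.I)
  have h : Complex.exp (a * Complex.I) = Complex.exp (a / 2 * Complex.I) * Complex.exp (a / 2 * Complex.I) := by
    rw [← Complex.exp_add]; congr 1; ring
  unfold Emat Gm
  ext i j
  fin_cases i <;> fin_cases j <;> simp [k2, n2, h]

lemma Gm_ell (a0 a : ℝ) (ha : 0 < a) (ha' : a < 2 * π) (p q : ℂ)
    (h : p * star p - q * star q = 1) (hre : p.re = cos (a / 2)) (him : 0 < p.im) :
    ellType (Gm a0 a p q) a0 a := by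
  have s := sin_pos_of_pos_of_lt_pi (x := a / 2) (by linarith) (by linarith)
  have sc := sin_sq_add_cos_sq (a / 2)
  set S := sin (a / 2) with hS
  set c := cos (a / 2) with hc
  obtain ⟨y, hy⟩ : ∃ y, p.im = y * S := ⟨p.im / S, by field_simp⟩
  have hy0 : 0 < y := by rw [hy] at him; exact pos_of_mul_pos_left him s.le
  have hq : (y ^ 2 - 1) * S ^ 2 = q.re ^ 2 + q.im ^ 2 := by
    have := congrArg Complex.re h
    simp [hre, hy] at this
    nlinarith
  set r := √((y + 1) / 2) with hr
  have hr2 : r ^ 2 = (y + 1) / 2 := Real.sq_sqrt (by linarith)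
  have hr0 : 0 < r := Real.sqrt_pos.mpr (by linarith)
  set z : ℂ := Complex.I * q * ((1 / (2 * r * S) : ℝ) : ℂ) with hz
  have hzz : z * star z = (((y - 1) / 2 : ℝ) : ℂ) := by
    have : z * star z = (((q.re ^ 2 + q.im ^ 2) * (1 / (2 * r * S)) ^ 2 : ℝ) : ℂ) := by
      rw [hz]; generalize 1 / (2 * r * S) = k
      apply Complex.ext <;> simp [← Complex.ofReal_pow] <;> ring
    rw [this, ← hq]
    congr 1
    rw [div_pow, mul_pow, mul_pow, hr2]
    field_simp
    ring
  have hrr : (r : ℂ) * r = (((y + 1) / 2 : ℝ) : ℂ) := by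
    rw [← hr2]; push_cast; ring
  have hdet : (r : ℂ) * star (r : ℂ) - z * star z = 1 := by
    rw [hzz]
    have : star (r : ℂ) = r := by simp
    rw [this, hrr]; push_cast; ring
  have hrz : (r : ℂ) * z = Complex.I * q * ((1 / (2 * S) : ℝ) : ℂ) := by
    rw [hz]
    have : (r : ℂ) ≠ 0 := by exact_mod_cast hr0.ne'
    have : (S : ℂ) ≠ 0 := by exact_mod_cast s.ne'
    push_cast
    field_simp
  have hexp : Complex.exp (a / 2 * Complex.I) = c + S * Complex.I := by
    rw [Complex.exp_mul_I, hc, hS]; push_cast; ring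
  refine ⟨Gm 0 0 r z, Gm_U _ _ _ _ hdet, ?_⟩
  rw [Gm_inv _ _ hdet, Emat_eq, Gm_mul, Gm_mul, hexp]
  have hS0 : (S : ℂ) ≠ 0 := by exact_mod_cast s.ne'
  have I2 := Complex.I_mul_I
  have e1 : p = ((r * (c + S * Complex.I) + z * star 0) * star (r : ℂ) + (r * 0 + z * star (c + S * Complex.I : ℂ)) * star (-z)) := by
    have hp : p = c + (y * S : ℝ) * Complex.I := by
      rw [← hy, ← hre]; exact (Complex.re_add_im p).symm
    rw [hp]
    have t : z * (starRingEnd ℂ) z = (((y - 1) / 2 : ℝ) : ℂ) := hzz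
    simp
    push_cast at t hrr
    linear_combination (-(c : ℂ) - S * Complex.I) * hrr + (c - S * Complex.I) * t
  have e2 : q = ((r * (c + S * Complex.I) + z * star 0) * (-z) + (r * 0 + z * star (c + S * Complex.I : ℂ)) * star (star (r : ℂ))) := by
    simp
    push_cast at hrz
    have : Complex.I * q * (1 / (2 * S)) * (2 * S) = Complex.I * q := by field_simp
    linear_combination (2 * S * Complex.I) * hrz + Complex.I * this + q * I2
  rw [← e1, ← e2]; simp

lemma ell_swap {M : M3} {a b : ℝ} (h : ellType M a b) : ellType M b a := by
  obtain ⟨P, hP, rfl⟩ := h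
  set Q : M3 := !![0, 1, 0; 1, 0, 0; 0, 0, 1] with hQ
  have hQQ : Q * Q = 1 := by
    ext i j; fin_cases i <;> fin_cases j <;> simp [hQ, Matrix.mul_apply, Fin.sum_univ_three]
  have hQi : Q⁻¹ = Q := Matrix.inv_eq_right_inv hQQ
  have hQU : Qᴴ * J3 * Q = J3 := by
    ext i j; fin_cases i <;> fin_cases j <;>
      simp [hQ, J3, Matrix.mul_apply, Fin.sum_univ_three, Matrix.diagonal_apply]
  have hE : Q * Emat b a * Q = Emat a b := by
    ext i j; fin_cases i <;> fin_cases j <;>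
      simp [hQ, Emat, Matrix.mul_apply, Fin.sum_univ_three, Matrix.vecMul_diagonal]
  refine ⟨P * Q, ?_, ?_⟩
  · unfold memU21 at *
    rw [Matrix.conjTranspose_mul]
    calc Qᴴ * Pᴴ * J3 * (P * Q) = Qᴴ * (Pᴴ * J3 * P) * Q := by simp only [Matrix.mul_assoc]
      _ = J3 := by rw [hP, hQU]
  · rw [Matrix.mul_inv_rev, hQi, ← hE]; simp only [Matrix.mul_assoc]

/-- Realisation lemma. -/
lemma realise {a0 a b0 b c0 c : ℝ} (ha : 0 < a) (ha' : a < 2 * π) (hb : 0 < b) (hb' : b < 2 * π)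
    (hc : 0 < c) (hc' : c < 2 * π) (m : ℤ) (hH : 2 * (a0 + b0 + c0) - (a + b + c) = 2 * π * m)
    (hm : (Odd m ∧ a + b + c ≤ 2 * π) ∨ (Even m ∧ 4 * π ≤ a + b + c)) :
    ∃ A B C : M3, memU21 A ∧ memU21 B ∧ memU21 C ∧
        ellType A a0 a ∧ ellType B b0 b ∧ ellType C c0 c ∧
        (∃ lam : ℂ, A * B * C = lam • (1 : M3)) ∧
        (∃ v : Fin 3 → ℂ, v ≠ 0 ∧
          (∃ a : ℂ, A.mulVec v = a • v) ∧ (∃ b : ℂ, B.mulVec v = b • v) ∧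
          (∃ c : ℂ, C.mulVec v = c • v) ∧
          (∃ r : ℝ, 0 < r ∧ star v ⬝ᵥ J3.mulVec v = (r : ℂ))) := by
  obtain ⟨e, he2, heexp, x, hx, e1, e2⟩ : ∃ e : ℝ, e * e = 1 ∧
      Complex.exp (π * m * Complex.I) = e ∧ ∃ x : ℝ, 1 ≤ x ∧
      cos (a / 2) * cos (b / 2) - x * (sin (a / 2) * sin (b / 2)) = e * cos (c / 2) ∧
      0 < -e * (sin (a / 2) * cos (b / 2) + x * (cos (a / 2) * sin (b / 2))) := by
    rcases hm with ⟨⟨k, rfl⟩, h⟩ | ⟨⟨k, rfl⟩, h⟩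
    · refine ⟨-1, by norm_num, ?_, ?_⟩
      · have : (π * ((2 * k + 1 : ℤ) : ℂ) * Complex.I) = π * Complex.I + k * (2 * π * Complex.I) := by
          push_cast; ring
        rw [this, Complex.exp_add, Complex.exp_int_mul_two_pi_mul_I, Complex.exp_pi_mul_I]
        simp
      · obtain ⟨x, hx, h1, h2⟩ := exist_core (t1 := a / 2) (t2 := b / 2) (t3 := c / 2)
          (by linarith) (by linarith) (by linarith) (by linarith) (by linarith) (by linarith)
          (by linarith)
        exact ⟨x, hx, by linarith, by linarith⟩
    · refine ⟨1, by norm_num, ?_, ?_⟩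
      · have : (π * ((k + k : ℤ) : ℂ) * Complex.I) = k * (2 * π * Complex.I) := by
          push_cast; ring
        rw [this, Complex.exp_int_mul_two_pi_mul_I]
        simp
      · obtain ⟨x, hx, h1, h2⟩ := exist_core (t1 := π - a / 2) (t2 := π - b / 2) (t3 := π - c / 2)
          (by linarith) (by linarith) (by linarith) (by linarith) (by linarith) (by linarith)
          (by linarith)
        simp only [cos_pi_sub, sin_pi_sub] at h1 h2
        exact ⟨x, hx, by linarith, by linarith⟩
  have s1 := sin_sq_add_cos_sq (a / 2)
  have s2 := sin_sq_add_cos_sq (b / 2)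
  have sp1 := sin_pos_of_pos_of_lt_pi (x := a / 2) (by linarith) (by linarith)
  have sp2 := sin_pos_of_pos_of_lt_pi (x := b / 2) (by linarith) (by linarith)
  set u := √(x ^ 2 - 1) * sin (b / 2) with hu
  have hu2 : u * u = (x ^ 2 - 1) * sin (b / 2) ^ 2 := by
    have := Real.sq_sqrt (show 0 ≤ x ^ 2 - 1 by nlinarith)
    rw [hu]; linear_combination sin (b / 2) ^ 2 * this
  clear_value u
  set C1 := cos (a / 2)
  set C2 := cos (b / 2)
  set S1 := sin (a / 2)
  set S2 := sin (b / 2)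
  set w : ℂ := ⟨C1, S1⟩ with hw
  set p : ℂ := ⟨C2, x * S2⟩ with hp
  have hww : w * star w - 0 * star (0 : ℂ) = 1 := by
    apply Complex.ext <;> simp [hw] <;> nlinarith
  have hpp : p * star p - (u : ℂ) * star (u : ℂ) = 1 := by
    apply Complex.ext <;> simp [hp] <;> nlinarith
  have hww' : w * star w = 1 := by simpa using hww
  have he2' : (e : ℂ) * e = 1 := by exact_mod_cast he2
  have hPP : (e * star (w * p)) * star (e * star (w * p)) - (-e * w * u) * star (-e * w * (u : ℂ)) = 1 := by
    simp only [star_mul', star_star, star_neg]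
    have : star (e : ℂ) = e := by simp
    rw [this]
    linear_combination (e * e) * (w * star w) * hpp + w * star w * he2' + hww'
  refine ⟨Gm a0 a w 0, Gm b0 b p u, Gm c0 c (e * star (w * p)) (- e * w * u),
    Gm_U _ _ _ _ hww, Gm_U _ _ _ _ hpp, Gm_U _ _ _ _ hPP,
    Gm_ell _ _ ha ha' _ _ hww rfl sp1, Gm_ell _ _ hb hb' _ _ hpp rfl (by simp [hp]; positivity),
    Gm_ell _ _ hc hc' _ _ hPP ?_ ?_, ⟨Complex.exp ((a0 + b0 + c0 : ℝ) * Complex.I), ?_⟩,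
    Pi.single 0 1, by simp, ?_, ?_, ?_, 1, one_pos, ?_⟩
  · simp [hw, hp]
    linear_combination e * e1 + cos (c / 2) * he2
  · simp [hw, hp]
    linarith
  · rw [Gm_mul, Gm_mul]
    have t1 : (w * p + 0 * star (u : ℂ)) * (e * star (w * p)) +
        (w * u + 0 * star p) * star (-e * w * (u : ℂ)) = e := by
      simp only [star_mul', star_star, star_neg]
      have : star (e : ℂ) = e := by simp
      rw [this]
      linear_combination e * (w * star w) * hpp + e * hww'
    have t2 : (w * p + 0 * star (u : ℂ)) * (-e * w * u) +
        (w * u + 0 * star p) * star (e * star (w * p)) = 0 := by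
      simp only [star_mul', star_star, star_neg]
      have : star (e : ℂ) = e := by simp
      rw [this]
      ring
    rw [t1, t2]
    have t3 : Complex.exp ((a + b + c : ℝ) / 2 * Complex.I) * e =
        Complex.exp ((a0 + b0 + c0 : ℝ) * Complex.I) := by
      rw [← heexp, ← Complex.exp_add]
      have : a0 + b0 + c0 = (a + b + c) / 2 + π * m := by linarith
      rw [this]; push_cast; ring_nf
    unfold Gm
    ext i j
    fin_cases i <;> fin_cases j <;> simp [-Complex.ofReal_add, t3]
  · exact ⟨Complex.exp (a0 * Complex.I), by ext i; fin_cases i <;> simp [Gm]⟩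
  · exact ⟨Complex.exp (b0 * Complex.I), by ext i; fin_cases i <;> simp [Gm]⟩
  · exact ⟨Complex.exp (c0 * Complex.I), by ext i; fin_cases i <;> simp [Gm]⟩
  · simp [J3]

lemma J3_sq : J3 * J3 = 1 := by
  unfold J3
  ext i j; fin_cases i <;> fin_cases j <;> simp

lemma U_left {P : M3} (h : memU21 P) : (J3 * Pᴴ * J3) * P = 1 := by
  unfold memU21 at h
  rw [Matrix.mul_assoc, Matrix.mul_assoc, ← Matrix.mul_assoc Pᴴ, h, J3_sq]

lemma U_inv {P : M3} (h : memU21 P) : P⁻¹ = J3 * Pᴴ * J3 :=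
  Matrix.inv_eq_left_inv (U_left h)

lemma U_inv_mul {P : M3} (h : memU21 P) : P⁻¹ * P = 1 := by rw [U_inv h, U_left h]

lemma U_mul_inv {P : M3} (h : memU21 P) : P * P⁻¹ = 1 := mul_eq_one_comm.mp (U_inv_mul h)

lemma U_right {P : M3} (h : memU21 P) : P * J3 * Pᴴ = J3 := by
  have := U_mul_inv h
  rw [U_inv h] at this
  calc P * J3 * Pᴴ = P * (J3 * Pᴴ * J3) * J3 := by
        simp only [Matrix.mul_assoc, J3_sq, Matrix.mul_one]
    _ = J3 := by rw [this, Matrix.one_mul]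

lemma J3_H : J3ᴴ = J3 := by
  unfold J3
  ext i j; fin_cases i <;> fin_cases j <;> simp [Matrix.diagonal_apply]

lemma U_inv_mem {P : M3} (h : memU21 P) : memU21 P⁻¹ := by
  have hr := U_right h
  rw [U_inv h]
  unfold memU21
  simp only [Matrix.conjTranspose_mul, Matrix.conjTranspose_conjTranspose, J3_H]
  calc J3 * (P * J3) * J3 * (J3 * Pᴴ * J3) = J3 * (P * J3 * (J3 * J3) * Pᴴ) * J3 := by
        simp only [Matrix.mul_assoc]
    _ = J3 * J3 * J3 := by rw [J3_sq, Matrix.mul_one, hr, J3_sq]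
    _ = J3 := by rw [J3_sq, Matrix.one_mul]

lemma U_mul_mem {P Q : M3} (hP : memU21 P) (hQ : memU21 Q) : memU21 (P * Q) := by
  unfold memU21 at *
  rw [Matrix.conjTranspose_mul]
  calc Qᴴ * Pᴴ * J3 * (P * Q) = Qᴴ * (Pᴴ * J3 * P) * Q := by simp only [Matrix.mul_assoc]
    _ = J3 := by rw [hP, hQ]

lemma entry22 {Q : M3} (hQ : memU21 Q) (j : Fin 2) (h : Q 2 j.castSucc = 0) (b1 b2 : ℝ) :
    ∃ t : ℝ, 0 ≤ t ∧ (Q * Emat b1 b2 * Q⁻¹) 2 2 =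
      (1 + t) - t * Complex.exp (coord (b1, b2) (j + 1) * Complex.I) := by
  have hr := congrFun (congrFun (U_right hQ) 2) 2
  rw [U_inv hQ]
  fin_cases j
  · refine ⟨Complex.normSq (Q 2 1), Complex.normSq_nonneg _, ?_⟩
    rw [Complex.normSq_eq_conj_mul_self]
    simp at h
    simp [J3, Emat, Matrix.mul_apply, Fin.sum_univ_three, h, Matrix.diagonal_apply, coord] at hr ⊢
    linear_combination -hr
  · refine ⟨Complex.normSq (Q 2 0), Complex.normSq_nonneg _, ?_⟩
    rw [Complex.normSq_eq_conj_mul_self]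
    simp at h
    simp [J3, Emat, Matrix.mul_apply, Fin.sum_univ_three, h, Matrix.diagonal_apply, coord] at hr ⊢
    linear_combination -hr

lemma exp_ne {a b : ℝ} (h : a < b) (h' : b < a + 2 * π) :
    Complex.exp (a * Complex.I) ≠ Complex.exp (b * Complex.I) := by
  intro he
  rw [Complex.exp_eq_exp_iff_exists_int] at he
  obtain ⟨n, hn⟩ := he
  have := congrArg Complex.im hn
  simp at this
  have hp := pi_pos
  have h1 : (-1 : ℝ) < n := by nlinarith
  have h2 : (n : ℝ) < 0 := by nlinarith
  have h1' : (-1 : ℤ) < n := by exact_mod_cast h1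
  have h2' : n < 0 := by exact_mod_cast h2
  omega

lemma eig {P : M3} {a1 a2 : ℝ} (hP : memU21 P) (h0 : 0 < a2) (h : a2 < a1) (h' : a1 < 2 * π)
    {v : Fin 3 → ℂ} {m : ℂ} (hm : (P * Emat a1 a2 * P⁻¹).mulVec v = m • v)
    {r : ℝ} (hr : 0 < r) (hv : star v ⬝ᵥ J3.mulVec v = (r : ℂ)) :
    ∃ i : Fin 2, m = Complex.exp (coord (a1, a2) i * Complex.I) ∧
      ∃ s : ℂ, s ≠ 0 ∧ v = P.mulVec (Pi.single i.castSucc s) := by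
  set w := P⁻¹.mulVec v with hw
  have hvw : v = P.mulVec w := by rw [hw, Matrix.mulVec_mulVec, U_mul_inv hP, Matrix.one_mulVec]
  have hE : (Emat a1 a2).mulVec w = m • w := by
    have := congrArg P⁻¹.mulVec hm
    rw [Matrix.mulVec_mulVec, Matrix.mulVec_smul, ← hw] at this
    rw [← this, hw, Matrix.mulVec_mulVec]
    congr 1
    rw [← Matrix.mul_assoc, ← Matrix.mul_assoc, U_inv_mul hP, Matrix.one_mul]
  have hpos : star w ⬝ᵥ J3.mulVec w = (r : ℂ) := by
    have hinv := U_inv_mem hP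
    unfold memU21 at hinv
    rw [← hv, hw, Matrix.star_mulVec, Matrix.mulVec_mulVec, ← Matrix.dotProduct_mulVec,
      Matrix.mulVec_mulVec, ← Matrix.mul_assoc, hinv]
  clear_value w
  have k0 := congrFun hE 0
  have k1 := congrFun hE 1
  have k2 := congrFun hE 2
  simp [Emat, Matrix.mulVec_diagonal] at k0 k1 k2
  have n12 := exp_ne h (by linarith)
  have n01 : Complex.exp (a1 * Complex.I) ≠ 1 := by
    have := exp_ne (a := 0) (b := a1) (by linarith) (by linarith)
    simpa using this.symm
  have n02 : Complex.exp (a2 * Complex.I) ≠ 1 := by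
    have := exp_ne (a := 0) (b := a2) (by linarith) (by linarith)
    simpa using this.symm
  by_cases w0 : w 0 = 0
  · by_cases w1 : w 1 = 0
    · exfalso
      have := congrArg Complex.re hpos
      simp [J3, Matrix.mulVec_diagonal, dotProduct, Fin.sum_univ_three, w0, w1] at this
      nlinarith [sq_nonneg (w 2).re, sq_nonneg (w 2).im]
    · have e1 : Complex.exp (a2 * Complex.I) = m := by
        rcases k1 with k | k
        · exact k
        · exact absurd k w1
      have w2 : w 2 = 0 := by
        by_contra hne
        apply n02; rw [e1]
        exact (mul_right_cancel₀ hne ((one_mul _).trans k2)).symm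
      refine ⟨1, by simp [coord, e1], w 1, w1, ?_⟩
      rw [hvw]; congr 1
      ext l; fin_cases l <;> simp [w0, w2]
  · have e1 : Complex.exp (a1 * Complex.I) = m := by
      rcases k0 with k | k
      · exact k
      · exact absurd k w0
    have w2 : w 2 = 0 := by
      by_contra hne
      apply n01; rw [e1]
      exact (mul_right_cancel₀ hne ((one_mul _).trans k2)).symm
    have w1 : w 1 = 0 := by
      rcases k1 with k | k
      · exact absurd (k.trans e1.symm) n12
      · exact k
    refine ⟨0, by simp [coord, e1], w 0, w0, ?_⟩
    rw [hvw]; congr 1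
    ext l; fin_cases l <;> simp [w1, w2]

lemma Emat_det (a b : ℝ) : (Emat a b).det = Complex.exp ((a + b : ℝ) * Complex.I) := by
  simp [Emat, Matrix.det_diagonal, Fin.prod_univ_three, add_mul, Complex.exp_add]

lemma Emat_neg (a b : ℝ) : Emat a b * Emat (-a) (-b) = 1 := by
  unfold Emat
  ext i j; fin_cases i <;> fin_cases j <;> simp [← Complex.exp_add]

/-- Numerical consequence of the `(3,3)` entry identity. -/
lemma num_core {a b c s t u : ℝ} (ha : 0 < a) (ha' : a < 2 * π) (hb : 0 < b) (hb' : b < 2 * π)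
    (hc : 0 < c) (hc' : c < 2 * π) (ht : 0 ≤ t) (hu : 0 ≤ u) (m : ℤ)
    (hH : 2 * s - (a + b + c) = 2 * π * m)
    (heq : ((1 + t) - t * Complex.exp (b * Complex.I) : ℂ) =
      Complex.exp (s * Complex.I) * ((1 + u) - u * Complex.exp ((-c : ℝ) * Complex.I))) :
    (Odd m ∧ a + b + c ≤ 2 * π) ∨ (Even m ∧ 4 * π ≤ a + b + c) := by
  have hs : s = (a / 2 + b / 2 + c / 2) + π * m := by linarith
  obtain ⟨e, heexp, hem⟩ : ∃ e : ℝ, Complex.exp ((π * m : ℝ) * Complex.I) = e ∧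
      ((Odd m ∧ e = -1) ∨ (Even m ∧ e = 1)) := by
    rcases Int.even_or_odd' m with ⟨k, rfl | rfl⟩
    · refine ⟨1, ?_, Or.inr ⟨even_two_mul k, rfl⟩⟩
      have : ((π * ((2 * k : ℤ) : ℝ) : ℝ) * Complex.I) = k * (2 * π * Complex.I) := by
        push_cast; ring
      rw [this, Complex.exp_int_mul_two_pi_mul_I]
      simp
    · refine ⟨-1, ?_, Or.inl ⟨odd_two_mul_add_one k, rfl⟩⟩
      have : ((π * ((2 * k + 1 : ℤ) : ℝ) : ℝ) * Complex.I) =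
          π * Complex.I + k * (2 * π * Complex.I) := by
        push_cast; ring
      rw [this, Complex.exp_add, Complex.exp_int_mul_two_pi_mul_I, Complex.exp_pi_mul_I]
      simp
  have key : ∀ θ : ℝ, Complex.exp ((θ : ℝ) * Complex.I) = cos θ + sin θ * Complex.I := by
    intro θ; rw [Complex.exp_mul_I]; push_cast; rfl
  have expAdd : ∀ θ φ : ℝ, Complex.exp ((θ + φ : ℝ) * Complex.I) =
      Complex.exp (θ * Complex.I) * Complex.exp (φ * Complex.I) := by
    intro θ φ; rw [← Complex.exp_add]; congr 1; push_cast; ring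
  have expInv : ∀ θ : ℝ, Complex.exp ((-θ : ℝ) * Complex.I) * Complex.exp (θ * Complex.I) = 1 := by
    intro θ; rw [← expAdd]; simp
  have hbb : b = b / 2 + b / 2 := by ring
  have hcc : -c = -(c / 2) + -(c / 2) := by ring
  rw [hs, expAdd, expAdd, expAdd, heexp, hcc, expAdd] at heq
  have hb2 : Complex.exp (b * Complex.I) =
      Complex.exp ((b / 2 : ℝ) * Complex.I) * Complex.exp ((b / 2 : ℝ) * Complex.I) := by
    rw [← expAdd, ← hbb]
  rw [hb2] at heq
  have i1 := expInv (a / 2)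
  have i2 := expInv (b / 2)
  have i3 := expInv (c / 2)
  have K : Complex.exp ((-(a / 2) : ℝ) * Complex.I) *
      ((1 + t) * Complex.exp ((-(b / 2) : ℝ) * Complex.I) - t * Complex.exp ((b / 2 : ℝ) * Complex.I))
      = e * ((1 + u) * Complex.exp ((c / 2 : ℝ) * Complex.I)
        - u * Complex.exp ((-(c / 2) : ℝ) * Complex.I)) := by
    generalize Complex.exp ((a / 2 : ℝ) * Complex.I) = x1 at *
    generalize Complex.exp ((b / 2 : ℝ) * Complex.I) = x2 at *
    generalize Complex.exp ((c / 2 : ℝ) * Complex.I) = x3 at *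
    generalize Complex.exp ((-(a / 2) : ℝ) * Complex.I) = y1 at *
    generalize Complex.exp ((-(b / 2) : ℝ) * Complex.I) = y2 at *
    generalize Complex.exp ((-(c / 2) : ℝ) * Complex.I) = y3 at *
    have L : y1 * y2 * ((1 + t) - t * (x2 * x2)) = y1 * ((1 + t) * y2 - t * x2) := by
      linear_combination (-t * y1 * x2) * i2
    have R : y1 * y2 * (x1 * x2 * x3 * e * ((1 + u) - u * (y3 * y3))) =
        e * ((1 + u) * x3 - u * y3) := by
      have : y1 * y2 * (x1 * x2 * x3 * e * ((1 + u) - u * (y3 * y3))) =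
        (y1 * x1) * (y2 * x2) * (e * ((1 + u) * x3 - u * y3 * (y3 * x3))) := by ring
      rw [this, i1, i2, i3]; ring
    rw [← L, ← R, heq]
  rw [key, key, key, key, key] at K
  have Kr := congrArg Complex.re K
  have Ki := congrArg Complex.im K
  simp [-Complex.ofReal_cos, -Complex.ofReal_sin, -Complex.ofReal_div, -Complex.ofReal_neg] at Kr Ki
  rcases hem with ⟨hm, rfl⟩ | ⟨hm, rfl⟩
  · left
    refine ⟨hm, ?_⟩
    have := ineq_core (t1 := a / 2) (t2 := b / 2) (t3 := c / 2) (x := 1 + 2 * t) (y := 1 + 2 * u)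
      (by linarith) (by linarith) (by linarith) (by linarith) (by linarith) (by linarith)
      (by linarith) (by linarith) (by linear_combination Kr) (by linear_combination -Ki)
    linarith
  · right
    refine ⟨hm, ?_⟩
    have := ineq_core (t1 := π - a / 2) (t2 := π - b / 2) (t3 := π - c / 2)
      (x := 1 + 2 * t) (y := 1 + 2 * u)
      (by linarith) (by linarith) (by linarith) (by linarith) (by linarith) (by linarith)
      (by linarith) (by linarith)
      (by simp only [cos_pi_sub, sin_pi_sub]; linear_combination Kr)
      (by simp only [cos_pi_sub, sin_pi_sub]; linear_combination Ki)
    linarith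

lemma coord_bd {p : Pt} (h : memTo p) (i : Fin 2) : 0 < coord p i ∧ coord p i < 2 * π := by
  obtain ⟨h1, h2, h3⟩ := h
  fin_cases i <;> simp [coord] <;> constructor <;> linarith

lemma coord_sum (p : Pt) (i : Fin 2) : p.1 + p.2 = coord p i + coord p (i + 1) := by
  fin_cases i <;> simp [coord]
  ring

/-- The uniform form of the wall condition. -/
def Wall (τ : Tri) : Prop := ∃ i j k : Fin 2, ∃ m : ℤ, Hf τ i j k = 2 * π * m ∧
  ((Odd m ∧ sg τ (i + 1) (j + 1) (k + 1) ≤ 2 * π) ∨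
    (Even m ∧ 4 * π ≤ sg τ (i + 1) (j + 1) (k + 1)))

lemma forward {τ : Tri} (hτ : memTo3 τ) {A B C : M3}
    (hA : ellType A τ.1.1 τ.1.2) (hB : ellType B τ.2.1.1 τ.2.1.2) (hC : ellType C τ.2.2.1 τ.2.2.2)
    {lam : ℂ} (hABC : A * B * C = lam • (1 : M3)) {v : Fin 3 → ℂ} (hv0 : v ≠ 0)
    {a b c : ℂ} (hva : A.mulVec v = a • v) (hvb : B.mulVec v = b • v) (hvc : C.mulVec v = c • v)
    {r : ℝ} (hr : 0 < r) (hv : star v ⬝ᵥ J3.mulVec v = (r : ℂ)) : Wall τ := by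
  obtain ⟨hα, hβ, hγ⟩ := hτ
  obtain ⟨P, hP, rfl⟩ := hA
  obtain ⟨PB, hPB, rfl⟩ := hB
  obtain ⟨PC, hPC, rfl⟩ := hC
  obtain ⟨i, ha, s, hs, hvs⟩ := eig hP hα.1 hα.2.1 hα.2.2 hva hr hv
  obtain ⟨j, hb, sB, hsB, hvB⟩ := eig hPB hβ.1 hβ.2.1 hβ.2.2 hvb hr hv
  obtain ⟨k, hc, sC, hsC, hvC⟩ := eig hPC hγ.1 hγ.2.1 hγ.2.2 hvc hr hv
  have hlam : lam = a * b * c := by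
    have h1 := congrArg (fun M : M3 => M.mulVec v) hABC
    simp only [← Matrix.mulVec_mulVec] at h1 hva hvb hvc
    simp only [hvc, hvb, hva, Matrix.mulVec_smul, Matrix.smul_mulVec, Matrix.one_mulVec, smul_smul]
      at h1
    have h2 := smul_left_injective ℂ hv0 h1
    rw [← h2]; ring
  have hlam' : lam = Complex.exp ((sg τ i j k : ℝ) * Complex.I) := by
    rw [hlam, ha, hb, hc, ← Complex.exp_add, ← Complex.exp_add, sg]
    congr 1; push_cast; ring
  -- determinant
  have hdetc : ∀ (Q : M3) (E : M3), memU21 Q → (Q * E * Q⁻¹).det = E.det := by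
    intro Q E hQ
    have h1 : Q.det * Q⁻¹.det = 1 := by rw [← Matrix.det_mul, U_mul_inv hQ, Matrix.det_one]
    rw [Matrix.det_mul, Matrix.det_mul]; linear_combination E.det * h1
  obtain ⟨m, hm⟩ : ∃ m : ℤ, Hf τ i j k = 2 * π * m := by
    have h1 := congrArg Matrix.det hABC
    rw [Matrix.det_mul, Matrix.det_mul, hdetc _ _ hP, hdetc _ _ hPB, hdetc _ _ hPC,
      Emat_det, Emat_det, Emat_det, Matrix.det_smul, Matrix.det_one, hlam', ← Complex.exp_add,
      ← Complex.exp_add, mul_one, Fintype.card_fin, ← Complex.exp_nat_mul,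
      Complex.exp_eq_exp_iff_exists_int] at h1
    obtain ⟨n, hn⟩ := h1
    have h2 := congrArg Complex.im hn
    simp only [coord_sum τ.1 i, coord_sum τ.2.1 j, coord_sum τ.2.2 k] at h2
    simp at h2
    refine ⟨-n, ?_⟩
    simp only [Hf, sg] at h2 ⊢
    push_cast
    linarith
  refine ⟨i, j, k, m, hm, ?_⟩
  have hPi := U_inv_mem hP
  have hQB := U_mul_mem hPi hPB
  have hQC := U_mul_mem hPi hPC
  have v2 : (P⁻¹.mulVec v) 2 = 0 := by
    rw [hvs, Matrix.mulVec_mulVec, U_inv_mul hP, Matrix.one_mulVec]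
    fin_cases i <;> simp
  have zB : (P⁻¹ * PB) 2 j.castSucc = 0 := by
    rw [hvB, Matrix.mulVec_mulVec] at v2
    simpa [Matrix.mulVec_single, hsB] using v2
  have zC : (P⁻¹ * PC) 2 k.castSucc = 0 := by
    rw [hvC, Matrix.mulVec_mulVec] at v2
    simpa [Matrix.mulVec_single, hsC] using v2
  obtain ⟨t, ht, etB⟩ := entry22 hQB j zB τ.2.1.1 τ.2.1.2
  obtain ⟨u, hu, etC⟩ := entry22 hQC k zC (-τ.2.2.1) (-τ.2.2.2)
  have bα := coord_bd hα (i + 1)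
  have bβ := coord_bd hβ (j + 1)
  have bγ := coord_bd hγ (k + 1)
  refine num_core bα.1 bα.2 bβ.1 bβ.2 bγ.1 bγ.2 ht hu m hm ?_
  have hneg : coord (-τ.2.2.1, -τ.2.2.2) (k + 1) = - coord τ.2.2 (k + 1) := by
    unfold coord; split_ifs <;> rfl
  rw [hneg] at etC
  rw [← hlam', ← etC]
  refine etB.symm.trans ?_
  have hi : ∀ {Q R : M3}, memU21 Q → memU21 R → (Q⁻¹ * R)⁻¹ = R⁻¹ * Q := by
    intro Q R hQ hR
    apply Matrix.inv_eq_right_inv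
    calc Q⁻¹ * R * (R⁻¹ * Q) = Q⁻¹ * (R * R⁻¹) * Q := by simp only [Matrix.mul_assoc]
      _ = 1 := by rw [U_mul_inv hR, Matrix.mul_one, U_inv_mul hQ]
  rw [hi hP hPB, hi hP hPC]
  have hmat : Emat τ.1.1 τ.1.2 * (P⁻¹ * PB * Emat τ.2.1.1 τ.2.1.2 * (PB⁻¹ * P)) =
      lam • (P⁻¹ * PC * Emat (-τ.2.2.1) (-τ.2.2.2) * (PC⁻¹ * P)) := by
    have h1 := congrArg (fun M : M3 =>
      P⁻¹ * M * (PC * Emat (-τ.2.2.1) (-τ.2.2.2) * (PC⁻¹ * P))) hABC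
    calc _ = (P⁻¹ * P) * (Emat τ.1.1 τ.1.2 * (P⁻¹ * PB * Emat τ.2.1.1 τ.2.1.2 * (PB⁻¹ *
              (PC * (Emat τ.2.2.1 τ.2.2.2 * ((PC⁻¹ * PC) * Emat (-τ.2.2.1) (-τ.2.2.2))) * PC⁻¹ * P))))
              := by
            rw [U_inv_mul hPC, U_inv_mul hP, Matrix.one_mul, Matrix.one_mul, Emat_neg,
              Matrix.mul_one, U_mul_inv hPC, Matrix.one_mul]
      _ = _ := by simp only [Matrix.mul_assoc]
      _ = _ := h1
      _ = _ := by
        rw [Matrix.mul_smul, Matrix.smul_mul, Matrix.mul_one]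
        simp only [Matrix.mul_assoc]
  have h22 := congrFun (congrFun hmat 2) 2
  rw [Matrix.smul_apply, smul_eq_mul] at h22
  rw [← h22]
  simp [Emat, Matrix.diagonal_mul]

lemma ell_coord {M : M3} {p : Pt} (i : Fin 2) (h : ellType M (coord p i) (coord p (i + 1))) :
    ellType M p.1 p.2 := by
  fin_cases i
  · simpa [coord] using h
  · simp [coord] at h; exact ell_swap h

set_option maxHeartbeats 4000000 in
lemma wall_iff {τ : Tri} (hτ : memTo3 τ) : Wall τ ↔ τ ∈ Wred := by
  have hp := pi_pos
  obtain ⟨⟨a1, a2⟩, ⟨b1, b2⟩, ⟨c1, c2⟩⟩ := τ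
  obtain ⟨⟨ha0, ha1, ha2⟩, ⟨hb0, hb1, hb2⟩, ⟨hc0, hc1, hc2⟩⟩ := hτ
  simp only at ha0 ha1 ha2 hb0 hb1 hb2 hc0 hc1 hc2
  have hT : memT3 ((a1, a2), (b1, b2), (c1, c2)) := by
    refine ⟨⟨?_, ?_, ?_, ?_, ?_⟩, ⟨?_, ?_, ?_, ?_, ?_⟩, ⟨?_, ?_, ?_, ?_, ?_⟩⟩ <;> simp only <;>
      linarith
  constructor
  · rintro ⟨i, j, k, m, hm, h⟩
    refine ⟨hT, ?_⟩
    have hlo : (-3 : ℝ) < m := by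
      fin_cases i <;> fin_cases j <;> fin_cases k <;> simp [Hf, sg, coord] at hm <;> nlinarith
    have hhi : (m : ℝ) < 6 := by
      fin_cases i <;> fin_cases j <;> fin_cases k <;> simp [Hf, sg, coord] at hm <;> nlinarith
    have hlo' : -3 < m := by exact_mod_cast hlo
    have hhi' : m < 6 := by exact_mod_cast hhi
    have h' : (m = -1 ∨ m = 1 ∨ m = 3 ∨ m = 5) ∧ sg ((a1, a2), (b1, b2), (c1, c2)) (i + 1) (j + 1) (k + 1) ≤ 2 * π ∨
        (m = -2 ∨ m = 0 ∨ m = 2 ∨ m = 4) ∧ 4 * π ≤ sg ((a1, a2), (b1, b2), (c1, c2)) (i + 1) (j + 1) (k + 1) := by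
      rcases h with ⟨⟨n, hn⟩, h⟩ | ⟨⟨n, hn⟩, h⟩
      · exact Or.inl ⟨by omega, h⟩
      · exact Or.inr ⟨by omega, h⟩
    clear h hlo hhi hlo' hhi' hT
    simp only [Hf, sg, coord, Fin.isValue, if_true, zero_add, one_ne_zero, if_false,
      show (1 + 1 : Fin 2) = 0 from rfl]
    rcases h' with ⟨rfl | rfl | rfl | rfl, h⟩ | ⟨rfl | rfl | rfl | rfl, h⟩ <;>
    fin_cases i <;> fin_cases j <;> fin_cases k <;> simp [Hf, sg, coord] at hm h <;>
    first
    | (exfalso; linarith)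
    | (repeat first
        | linarith
        | (refine Or.inl ?_; linarith)
        | (refine Or.inl ⟨?_, ?_⟩ <;> linarith)
        | apply Or.inr)
  · rintro ⟨-, h⟩
    rcases h with h | h | h | h | h | h | h | h | h | h | h | h | h | h | h | h | h | h | h | h | h
      | h | h | h
    · refine ⟨1, 1, 1, -2, by rw [h]; push_cast; ring, Or.inr ⟨by decide, ?_⟩⟩
      simp [Hf, sg, coord] at h ⊢; linarith
    · exact ⟨1, 1, 1, 0, by rw [h.1]; push_cast; ring, Or.inr ⟨by decide, h.2⟩⟩
    · exact ⟨1, 1, 0, 0, by rw [h.1]; push_cast; ring, Or.inr ⟨by decide, h.2⟩⟩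
    · exact ⟨1, 0, 1, 0, by rw [h.1]; push_cast; ring, Or.inr ⟨by decide, h.2⟩⟩
    · exact ⟨0, 1, 1, 0, by rw [h.1]; push_cast; ring, Or.inr ⟨by decide, h.2⟩⟩
    · exact ⟨1, 1, 0, 1, by rw [h.1]; push_cast; ring, Or.inl ⟨by decide, h.2⟩⟩
    · exact ⟨1, 0, 1, 1, by rw [h.1]; push_cast; ring, Or.inl ⟨by decide, h.2⟩⟩
    · exact ⟨0, 1, 1, 1, by rw [h.1]; push_cast; ring, Or.inl ⟨by decide, h.2⟩⟩
    · exact ⟨0, 0, 1, 1, by rw [h.1]; push_cast; ring, Or.inl ⟨by decide, h.2⟩⟩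
    · exact ⟨0, 1, 0, 1, by rw [h.1]; push_cast; ring, Or.inl ⟨by decide, h.2⟩⟩
    · exact ⟨1, 0, 0, 1, by rw [h.1]; push_cast; ring, Or.inl ⟨by decide, h.2⟩⟩
    · exact ⟨0, 0, 0, 1, by rw [h.1]; push_cast; ring, Or.inl ⟨by decide, h.2⟩⟩
    · exact ⟨1, 1, 1, 2, by rw [h.1]; push_cast; ring, Or.inr ⟨by decide, h.2⟩⟩
    · exact ⟨1, 1, 0, 2, by rw [h.1]; push_cast; ring, Or.inr ⟨by decide, h.2⟩⟩
    · exact ⟨1, 0, 1, 2, by rw [h.1]; push_cast; ring, Or.inr ⟨by decide, h.2⟩⟩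
    · exact ⟨0, 1, 1, 2, by rw [h.1]; push_cast; ring, Or.inr ⟨by decide, h.2⟩⟩
    · exact ⟨0, 0, 1, 2, by rw [h.1]; push_cast; ring, Or.inr ⟨by decide, h.2⟩⟩
    · exact ⟨0, 1, 0, 2, by rw [h.1]; push_cast; ring, Or.inr ⟨by decide, h.2⟩⟩
    · exact ⟨1, 0, 0, 2, by rw [h.1]; push_cast; ring, Or.inr ⟨by decide, h.2⟩⟩
    · exact ⟨0, 0, 0, 3, by rw [h.1]; push_cast; ring, Or.inl ⟨by decide, h.2⟩⟩
    · exact ⟨0, 0, 1, 3, by rw [h.1]; push_cast; ring, Or.inl ⟨by decide, h.2⟩⟩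
    · exact ⟨0, 1, 0, 3, by rw [h.1]; push_cast; ring, Or.inl ⟨by decide, h.2⟩⟩
    · exact ⟨1, 0, 0, 3, by rw [h.1]; push_cast; ring, Or.inl ⟨by decide, h.2⟩⟩
    · refine ⟨0, 0, 0, 5, by rw [h]; push_cast; ring, Or.inl ⟨by decide, ?_⟩⟩
      simp [Hf, sg, coord] at h ⊢; linarith

/-- Hyperbolic reducible walls in PU(2,1). -/
theorem hyperbolic_reducible_walls :
    {τ : Tri | memTo3 τ ∧ ∃ A B C : M3, memU21 A ∧ memU21 B ∧ memU21 C ∧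
        ellType A τ.1.1 τ.1.2 ∧ ellType B τ.2.1.1 τ.2.1.2 ∧ ellType C τ.2.2.1 τ.2.2.2 ∧
        (∃ lam : ℂ, A * B * C = lam • (1 : M3)) ∧
        (∃ v : Fin 3 → ℂ, v ≠ 0 ∧
          (∃ a : ℂ, A.mulVec v = a • v) ∧ (∃ b : ℂ, B.mulVec v = b • v) ∧
          (∃ c : ℂ, C.mulVec v = c • v) ∧
          (∃ r : ℝ, 0 < r ∧ star v ⬝ᵥ J3.mulVec v = (r : ℂ)))} =
      Wred ∩ {τ : Tri | memTo3 τ} := by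
  ext τ
  constructor
  · rintro ⟨hτ, A, B, C, -, -, -, hA, hB, hC, ⟨lam, hl⟩, v, hv0, ⟨a, ha⟩, ⟨b, hb⟩, ⟨c, hc⟩,
      r, hr, hv⟩
    exact ⟨(wall_iff hτ).mp (forward hτ hA hB hC hl hv0 ha hb hc hr hv), hτ⟩
  · rintro ⟨hW, hτ⟩
    obtain ⟨i, j, k, m, hm, h⟩ := (wall_iff hτ).mpr hW
    have bα := coord_bd hτ.1 (i + 1)
    have bβ := coord_bd hτ.2.1 (j + 1)
    have bγ := coord_bd hτ.2.2 (k + 1)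
    obtain ⟨A, B, C, uA, uB, uC, hA, hB, hC, rest⟩ :=
      realise bα.1 bα.2 bβ.1 bβ.2 bγ.1 bγ.2 m hm h
    exact ⟨hτ, A, B, C, uA, uB, uC, ell_coord i hA, ell_coord j hB, ell_coord k hC, rest⟩
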